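/- arXiv:math-ph/0507072 — 7 statements merged into one kernel-verified Lean document; each statement's English description precedes it below -/
import Mathlib

section
/- (Theorem 1, sufficiency.) Let α, β be real numbers with 0 ≤ α ≤ 1 and α² ≤ β ≤ 1, and set Ω = [−α, β]. Then Σ(Ω) is closed under multiplication: for all integers n₁, n₂, m₁, m₂ with n₁ + n₂τ' ∈ Ω and m₁ + m₂τ' ∈ Ω, setting p₁ = n₁m₁ + n₂m₂ and p₂ = n₁m₂ + n₂m₁ + n₂m₂ (so that (n₁+n₂τ)(m₁+m₂τ) = p₁ + p₂τ), one has p₁ + p₂τ' ∈ Ω; equivalently, the product of any two elements of Σ(Ω) again lies in Σ(Ω). -/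
noncomputable def tau : ℝ := (1 + Real.sqrt 5) / 2
noncomputable def tau' : ℝ := (1 - Real.sqrt 5) / 2

theorem tau'_sq : tau' ^ 2 = tau' + 1 := by
  have h : Real.sqrt 5 ^ 2 = 5 := Real.sq_sqrt (by norm_num)
  unfold tau'
  linear_combination h / 4

theorem mul_mem_Icc_neg {α β x y : ℝ} (hα0 : 0 ≤ α) (hα1 : α ≤ 1)
    (hβl : α ^ 2 ≤ β) (hβ1 : β ≤ 1) (hx : x ∈ Set.Icc (-α) β) (hy : y ∈ Set.Icc (-α) β) :
    x * y ∈ Set.Icc (-α) β := by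
  obtain ⟨hx₁, hx₂⟩ := hx
  obtain ⟨hy₁, hy₂⟩ := hy
  rcases le_total 0 x with hx | hx <;> rcases le_total 0 y with hy | hy <;>
    constructor <;> nlinarith

/-- Theorem 1 (sufficiency): for Ω = [−α, β] with 0 ≤ α ≤ 1 and α² ≤ β ≤ 1,
the model set Σ(Ω) is closed under multiplication. -/
theorem stmt2_model_set_mul_closed (α β : ℝ) (hα0 : 0 ≤ α) (hα1 : α ≤ 1)
    (hβl : α ^ 2 ≤ β) (hβ1 : β ≤ 1)
    (n₁ n₂ m₁ m₂ : ℤ)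
    (hn : (n₁ : ℝ) + n₂ * tau' ∈ Set.Icc (-α) β)
    (hm : (m₁ : ℝ) + m₂ * tau' ∈ Set.Icc (-α) β)
    (p₁ p₂ : ℤ)
    (hp₁ : p₁ = n₁ * m₁ + n₂ * m₂)
    (hp₂ : p₂ = n₁ * m₂ + n₂ * m₁ + n₂ * m₂) :
    (p₁ : ℝ) + p₂ * tau' ∈ Set.Icc (-α) β := by
  have hprod : (p₁ : ℝ) + p₂ * tau' = (n₁ + n₂ * tau') * (m₁ + m₂ * tau') := by
    rw [hp₁, hp₂]
    push_cast
    linear_combination -(n₂ * m₂ : ℝ) * tau'_sq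
  rw [hprod]
  exact mul_mem_Icc_neg hα0 hα1 hβl hβ1 hn hm
end

section
/- For all integers m₂ and n₂, the floor function identity ⌊(1/τ)·(m₂n₂ + m₂·⌊n₂/τ + 1⌋ + n₂·⌊m₂/τ + 1⌋) + 1⌋ = m₂n₂ + ⌊m₂/τ + 1⌋·⌊n₂/τ + 1⌋ holds. -/
lemma one_div_tau_sq : (1 / tau) ^ 2 = 1 - 1 / tau := by
  have hpos : 0 < tau := by unfold tau; positivity
  have hsq : tau ^ 2 = tau + 1 := by
    unfold tau
    linear_combination (1 / 4 : ℝ) * Real.sq_sqrt (show (0 : ℝ) ≤ 5 by norm_num)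
  field_simp
  linear_combination -hsq

/-- The floor-function identity encoding multiplicativity of the Fibonacci chain. -/
theorem stmt4_floor_identity (m₂ n₂ : ℤ) :
    ⌊(1 / tau) * ((m₂ * n₂ : ℤ)
        + m₂ * ⌊(n₂ : ℝ) / tau + 1⌋ + n₂ * ⌊(m₂ : ℝ) / tau + 1⌋ : ℝ) + 1⌋
      = m₂ * n₂ + ⌊(m₂ : ℝ) / tau + 1⌋ * ⌊(n₂ : ℝ) / tau + 1⌋ := by
  have hs := one_div_tau_sq
  rw [div_eq_mul_one_div (m₂ : ℝ), div_eq_mul_one_div (n₂ : ℝ)]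
  generalize 1 / tau = s at hs ⊢
  have ha₁ := Int.floor_le ((m₂ : ℝ) * s + 1)
  have ha₂ := Int.lt_floor_add_one ((m₂ : ℝ) * s + 1)
  have hb₁ := Int.floor_le ((n₂ : ℝ) * s + 1)
  have hb₂ := Int.lt_floor_add_one ((n₂ : ℝ) * s + 1)
  generalize ⌊(m₂ : ℝ) * s + 1⌋ = a at *
  generalize ⌊(n₂ : ℝ) * s + 1⌋ = b at *
  -- The left argument exceeds the right-hand side by exactly `1 - (a - m₂ s) (b - n₂ s)`.
  have key : s * (((m₂ * n₂ : ℤ) : ℝ) + m₂ * b + n₂ * a) + 1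
      = ((m₂ * n₂ + a * b : ℤ) : ℝ) + (1 - (a - m₂ * s) * (b - n₂ * s)) := by
    push_cast
    linear_combination (m₂ * n₂ : ℝ) * hs
  have hu : 0 < (a : ℝ) - m₂ * s := by linarith
  have hv : 0 < (b : ℝ) - n₂ * s := by linarith
  have huv : ((a : ℝ) - m₂ * s) * (b - n₂ * s) ≤ 1 :=
    mul_le_one₀ (by linarith) hv.le (by linarith)
  rw [key, Int.floor_eq_iff]
  constructor <;> linarith [mul_pos hu hv]
end

section
/- Define F : ℤ → ℝ by F(k) = kτ + ⌊k/τ + 1⌋. For all integers m₂ and n₂, setting p₂ = m₂n₂ + n₂·⌊m₂/τ + 1⌋ + m₂·⌊n₂/τ + 1⌋, one has F(m₂)·F(n₂) = F(p₂). That is, the Fibonacci chain parameterized by the floor-function formula is closed under multiplication, with the explicit composition law p₂ on the τ-components. -/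
/-- The Fibonacci chain parameterized by the floor function formula. -/
noncomputable def F (k : ℤ) : ℝ := k * tau + ⌊(k : ℝ) / tau + 1⌋

theorem tau_sq : tau ^ 2 = tau + 1 := Real.goldenRatio_sq

theorem div_tau (x : ℝ) : x / tau = x * (tau - 1) := by
  have h : tau ≠ 0 := Real.goldenRatio_ne_zero
  field_simp
  linear_combination -x * tau_sq

theorem floor_div_tau_add_one_eq_iff (k a : ℤ) :
    ⌊(k : ℝ) / tau + 1⌋ = a ↔ a - k * (tau - 1) ∈ Set.Ioc (0 : ℝ) 1 := by
  rw [Int.floor_eq_iff, div_tau, Set.mem_Ioc]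
  constructor <;> rintro ⟨h, h'⟩ <;> constructor <;> linarith

/-- The Fibonacci chain is closed under multiplication, with the explicit
composition law on the τ-components. -/
theorem stmt5_F_mul (m₂ n₂ p₂ : ℤ)
    (hp₂ : p₂ = m₂ * n₂ + n₂ * ⌊(m₂ : ℝ) / tau + 1⌋ + m₂ * ⌊(n₂ : ℝ) / tau + 1⌋) :
    F m₂ * F n₂ = F p₂ := by
  obtain ⟨hm, hm'⟩ := (floor_div_tau_add_one_eq_iff m₂ _).1 rfl
  obtain ⟨hn, hn'⟩ := (floor_div_tau_add_one_eq_iff n₂ _).1 rfl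
  unfold F
  generalize ⌊(m₂ : ℝ) / tau + 1⌋ = a at *
  generalize ⌊(n₂ : ℝ) / tau + 1⌋ = b at *
  have hp : ⌊(p₂ : ℝ) / tau + 1⌋ = m₂ * n₂ + a * b := by
    have conj_mul : ((m₂ * n₂ + a * b : ℤ) : ℝ) - p₂ * (tau - 1)
        = (a - m₂ * (tau - 1)) * (b - n₂ * (tau - 1)) := by
      rw [hp₂]
      push_cast
      linear_combination -(m₂ * n₂ : ℝ) * tau_sq
    rw [floor_div_tau_add_one_eq_iff, conj_mul]
    exact ⟨mul_pos hm hn, mul_le_one₀ hm' hn.le hn'⟩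
  rw [hp, hp₂]
  push_cast
  linear_combination (m₂ * n₂ : ℝ) * tau_sq
end

section
/- For all integers n₁ and n₂, one has n₁ + n₂τ' ∈ (0,1] if and only if n₁ = ⌊n₂/τ + 1⌋. Consequently the model set Σ((0,1]) coincides with the Fibonacci chain {n₂τ + ⌊n₂/τ + 1⌋ : n₂ ∈ ℤ}. -/
/-- The model set Σ(Ω): real numbers n₁ + n₂τ with n₁, n₂ ∈ ℤ and n₁ + n₂τ' ∈ Ω. -/
def modelSet (Ω : Set ℝ) : Set ℝ :=
  {x | ∃ n₁ n₂ : ℤ, x = (n₁ : ℝ) + n₂ * tau ∧ (n₁ : ℝ) + n₂ * tau' ∈ Ω}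

theorem div_tau_eq_neg_mul_tau' (x : ℝ) : x / tau = -(x * tau') := by
  have h5 : Real.sqrt 5 ^ 2 = 5 := Real.sq_sqrt (by norm_num)
  have htau : tau ≠ 0 := by
    unfold tau
    positivity
  rw [div_eq_iff htau]
  unfold tau tau'
  linear_combination (-x / 4) * h5

/-- n₁ + n₂τ' ∈ (0,1] iff n₁ = ⌊n₂/τ + 1⌋; consequently Σ((0,1]) is the
Fibonacci chain {n₂τ + ⌊n₂/τ + 1⌋ : n₂ ∈ ℤ}. -/
theorem stmt6_window_iff_floor :
    (∀ n₁ n₂ : ℤ, ((n₁ : ℝ) + n₂ * tau' ∈ Set.Ioc 0 1 ↔ n₁ = ⌊(n₂ : ℝ) / tau + 1⌋)) ∧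
    modelSet (Set.Ioc 0 1) = {x : ℝ | ∃ k : ℤ, x = k * tau + ⌊(k : ℝ) / tau + 1⌋} := by
  have window_iff (n₁ n₂ : ℤ) :
      (n₁ : ℝ) + n₂ * tau' ∈ Set.Ioc 0 1 ↔ n₁ = ⌊(n₂ : ℝ) / tau + 1⌋ := by
    rw [eq_comm, Int.floor_eq_iff, div_tau_eq_neg_mul_tau', Set.mem_Ioc]
    constructor <;> rintro ⟨h₁, h₂⟩ <;> constructor <;> linarith
  refine ⟨window_iff, ?_⟩
  ext x
  constructor
  · rintro ⟨n₁, n₂, rfl, h⟩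
    exact ⟨n₂, by rw [← (window_iff n₁ n₂).1 h, add_comm]⟩
  · rintro ⟨k, rfl⟩
    exact ⟨_, k, add_comm _ _, (window_iff _ k).2 rfl⟩
end

section
/- (Lemma 1.) Let n₁, n₂, m₁, m₂ be integers with m₁ + m₂τ' ∈ (0,1]. If n₁ + n₂τ' ∈ (0, 1/τ], then the element n + τ²m (where n = n₁ + n₂τ and m = m₁ + m₂τ) lies in Σ((0,1]), i.e. (n₁ + n₂τ') + (τ')²(m₁ + m₂τ') ∈ (0,1]. If instead n₁ + n₂τ' ∈ (1/τ, 1], then n + τm lies in Σ((0,1]), i.e. (n₁ + n₂τ') + τ'(m₁ + m₂τ') ∈ (0,1]. -/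
theorem tau'_neg : tau' < 0 := by
  have h : 1 < √(5 : ℝ) := Real.lt_sqrt_of_sq_lt (by norm_num)
  unfold tau'
  linarith

theorem one_div_tau : 1 / tau = -tau' := by
  have h : √(5 : ℝ) ^ 2 = 5 := Real.sq_sqrt (by norm_num)
  have hpos : 0 < tau := by unfold tau; positivity
  rw [div_eq_iff hpos.ne']
  unfold tau tau'
  linear_combination -h / 4

/-- Lemma 1: for n, m ∈ Σ((0,1]), if n* ∈ (0,1/τ] then n + τ²m ∈ Σ((0,1]),
while if n* ∈ (1/τ,1] then n + τm ∈ Σ((0,1]) (stated on Galois conjugates). -/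
theorem stmt9_graded_addition (n₁ n₂ m₁ m₂ : ℤ)
    (hm : (m₁ : ℝ) + m₂ * tau' ∈ Set.Ioc 0 1) :
    ((n₁ : ℝ) + n₂ * tau' ∈ Set.Ioc 0 (1 / tau) →
      ((n₁ : ℝ) + n₂ * tau') + tau' ^ 2 * ((m₁ : ℝ) + m₂ * tau') ∈ Set.Ioc 0 1) ∧
    ((n₁ : ℝ) + n₂ * tau' ∈ Set.Ioc (1 / tau) 1 →
      ((n₁ : ℝ) + n₂ * tau') + tau' * ((m₁ : ℝ) + m₂ * tau') ∈ Set.Ioc 0 1) := by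
  have htau' : tau' < 0 := tau'_neg
  have hsq : tau' ^ 2 = tau' + 1 := tau'_sq
  rw [one_div_tau]
  generalize (m₁ : ℝ) + m₂ * tau' = m at hm ⊢
  generalize (n₁ : ℝ) + n₂ * tau' = n
  obtain ⟨hm0, hm1⟩ := hm
  constructor
  · rintro ⟨hn0, hn1⟩
    have hpos : 0 < tau' ^ 2 * m := mul_pos (sq_pos_of_neg htau') hm0
    have hle : tau' ^ 2 * m ≤ tau' ^ 2 := mul_le_of_le_one_right (sq_nonneg _) hm1
    constructor <;> linarith
  · rintro ⟨hn0, hn1⟩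
    have hneg : tau' * m < 0 := mul_neg_of_neg_of_pos htau' hm0
    have hge : tau' ≤ tau' * m := by nlinarith
    constructor <;> linarith
end

section
/- (Lemma 3.) For a natural number a ≥ 1, say a real number x is compatible with grading a if x ∈ (0, 1 − τ^(−a)] when a is even and x ∈ (τ^(−a), 1] when a is odd. Then for all natural numbers a, b ≥ 1 and all real x, y, if x is compatible with grading a and y is compatible with grading b, then x + (τ')ᵃ·y is compatible with grading a + b. -/
/-- A real number x is compatible with grading a ≥ 1 if x ∈ (0, 1 − 1/τᵃ]
when a is even, and x ∈ (1/τᵃ, 1] when a is odd. -/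
def CompatibleGrading (a : ℕ) (x : ℝ) : Prop :=
  (Even a → x ∈ Set.Ioc 0 (1 - 1 / tau ^ a)) ∧ (Odd a → x ∈ Set.Ioc (1 / tau ^ a) 1)

theorem tau_pos : 0 < tau := by
  unfold tau
  positivity

theorem tau'_eq_neg_one_div_tau : tau' = -(1 / tau) := by
  have hmul : tau' * tau = -1 := by
    have h5 : Real.sqrt 5 ^ 2 = 5 := Real.sq_sqrt (by norm_num)
    unfold tau' tau
    linear_combination (-1 / 4) * h5
  rw [← neg_div, eq_div_iff tau_pos.ne', hmul]

/-- Lemma 3: graded addition respects the fine grading. -/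
theorem stmt11_graded_sum_compatible (a b : ℕ) (ha : 1 ≤ a) (hb : 1 ≤ b)
    (x y : ℝ) (hx : CompatibleGrading a x) (hy : CompatibleGrading b y) :
    CompatibleGrading (a + b) (x + tau' ^ a * y) := by
  have hp : 0 < 1 / tau ^ a := by have := tau_pos; positivity
  have hpq : 1 / tau ^ (a + b) = 1 / tau ^ a * (1 / tau ^ b) := by
    rw [pow_add, one_div_mul_one_div]
  rcases Nat.even_or_odd a with hae | hao
  · have hpow : tau' ^ a = 1 / tau ^ a := by
      rw [tau'_eq_neg_one_div_tau, hae.neg_pow, one_div_pow]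
    obtain ⟨hx0, hx1⟩ := hx.1 hae
    rw [CompatibleGrading, hpow, hpq]
    generalize 1 / tau ^ a = p at *
    refine ⟨fun hab => ?_, fun hab => ?_⟩
    · obtain ⟨hy0, hy1⟩ := hy.1 ((Nat.even_add.1 hab).1 hae)
      constructor <;> nlinarith
    · obtain ⟨hy0, hy1⟩ := hy.2 ((Nat.odd_add'.1 hab).2 hae)
      constructor <;> nlinarith
  · have hpow : tau' ^ a = -(1 / tau ^ a) := by
      rw [tau'_eq_neg_one_div_tau, hao.neg_pow, one_div_pow]
    obtain ⟨hx0, hx1⟩ := hx.2 hao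
    rw [CompatibleGrading, hpow, hpq]
    generalize 1 / tau ^ a = p at *
    refine ⟨fun hab => ?_, fun hab => ?_⟩
    · obtain ⟨hy0, hy1⟩ := hy.2 ((Nat.even_add'.1 hab).1 hao)
      constructor <;> nlinarith
    · obtain ⟨hy0, hy1⟩ := hy.1 ((Nat.odd_add.1 hab).1 hao)
      constructor <;> nlinarith
end

section
/- The Fibonacci chain decomposes self-similarly as the disjoint union Σ((0,1]) = (−τ)·Σ((0,1]) ∪ Σ((1/τ, 1]), where (−τ)·Σ((0,1]) = {−τx : x ∈ Σ((0,1])}, and the two sets on the right-hand side are disjoint. -/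
theorem neg_tau'_eq_one_div_tau : -tau' = 1 / tau := by
  rw [one_div]
  exact Real.inv_goldenRatio.symm

theorem irrational_tau : Irrational tau := by
  exact Real.goldenRatio_irrational

/-- The integer coordinates of an element of `ℤ[τ]` are unique. -/
theorem int_add_mul_tau_inj {a b c d : ℤ} (h : (a : ℝ) + b * tau = c + d * tau) :
    a = c ∧ b = d := by
  have hbd : b = d := by
    by_contra hne
    refine ((irrational_tau.intCast_mul (sub_ne_zero.mpr hne)).ne_int (c - a)) ?_
    push_cast
    linear_combination h
  subst hbd
  exact ⟨by exact_mod_cast add_right_cancel h, rfl⟩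

theorem modelSet_union (s t : Set ℝ) : modelSet (s ∪ t) = modelSet s ∪ modelSet t := by
  ext x
  simp only [modelSet, Set.mem_union, Set.mem_ofPred_eq, and_or_left, exists_or]

theorem disjoint_modelSet {s t : Set ℝ} (h : Disjoint s t) :
    Disjoint (modelSet s) (modelSet t) := by
  rw [Set.disjoint_left]
  rintro x ⟨a, b, rfl, hs⟩ ⟨c, d, hx, ht⟩
  obtain ⟨rfl, rfl⟩ := int_add_mul_tau_inj hx
  exact Set.disjoint_left.mp h hs ht

/-- Multiplication by the unit `-τ` acts on windows as multiplication by its conjugate. -/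
theorem image_neg_tau_mul_modelSet (s : Set ℝ) :
    (fun x : ℝ => -tau * x) '' modelSet s = modelSet ((fun x : ℝ => -tau' * x) '' s) := by
  ext y
  constructor
  · rintro ⟨_, ⟨a, b, rfl, hs⟩, rfl⟩
    refine ⟨-b, -(a + b), ?_, _, hs, ?_⟩
    · push_cast
      linear_combination -(b : ℝ) * tau_sq
    · push_cast
      linear_combination -(b : ℝ) * tau'_sq
  · rintro ⟨m, n, rfl, z, hz, hzm⟩
    have hz_eq : ((m - n : ℤ) : ℝ) + (-m : ℤ) * tau' = z := by
      push_cast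
      linear_combination (tau' - 1) * hzm + (n + z) * tau'_sq
    refine ⟨_, ⟨m - n, -m, rfl, hz_eq ▸ hz⟩, ?_⟩
    push_cast
    linear_combination (m : ℝ) * tau_sq

theorem image_neg_tau_mul_fibonacci_chain :
    (fun x : ℝ => -tau * x) '' modelSet (Set.Ioc 0 1) = modelSet (Set.Ioc 0 (1 / tau)) := by
  rw [image_neg_tau_mul_modelSet, neg_tau'_eq_one_div_tau,
    Set.image_mul_left_Ioc (one_div_pos.mpr tau_pos), mul_zero, mul_one]

/-- Self-similar decomposition of the Fibonacci chain:
Σ((0,1]) = (−τ)·Σ((0,1]) ∪ Σ((1/τ,1]), a disjoint union. -/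
theorem stmt14_self_similar_decomposition :
    modelSet (Set.Ioc 0 1)
      = (fun x : ℝ => -tau * x) '' modelSet (Set.Ioc 0 1)
        ∪ modelSet (Set.Ioc (1 / tau) 1) ∧
    Disjoint ((fun x : ℝ => -tau * x) '' modelSet (Set.Ioc 0 1))
      (modelSet (Set.Ioc (1 / tau) 1)) := by
  have htau : 1 ≤ tau := Real.one_lt_goldenRatio.le
  rw [image_neg_tau_mul_fibonacci_chain]
  refine ⟨?_, disjoint_modelSet (Set.Ioc_disjoint_Ioc_of_le le_rfl)⟩
  rw [← modelSet_union, Set.Ioc_union_Ioc_eq_Ioc (one_div_pos.mpr tau_pos).le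
    ((div_le_one tau_pos).mpr htau)]
end
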